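/- Let F be as in the random map construction, with θ(ξ) = μ + λ(ξ)ξ solving F(θ) − φ = ½ξᵀHξ. If one assigns each sample θ(ξ_j) (with ξ_j i.i.d. N(0,H⁻¹)) the weight w_j proportional to the Jacobian |J(ξ_j)| = |λ^{m−1} ξᵀHξ/(∇F(θ)·ξ)|, then the weighted samples target the density proportional to exp(−F); i.e., for bounded measurable u, E[u(θ(ξ)) |J(ξ)|] / E[|J(ξ)|] equals ∫ u(θ) e^{−F(θ)} dθ / ∫ e^{−F(θ)} dθ, provided the map ξ ↦ θ(ξ) is a diffeomorphism of ℝ^m \ {0}. -/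

import Mathlib

open Matrix MeasureTheory

/-- Change of variables for a random map: if `f` pulled back along `T` and weighted by the Jacobian
agrees with `h` away from `a`, then `f` and `h` have the same integral. -/
theorem integral_eq_of_bijOn_compl_singleton
    {E : Type*} [NormedAddCommGroup E] [NormedSpace ℝ E] [FiniteDimensional ℝ E]
    [MeasurableSpace E] [BorelSpace E] (ν : Measure E) [ν.IsAddHaarMeasure] [NullSingletonClass ν]
    {T : E → E} {T' : E → E →L[ℝ] E} {a b : E}
    (hbij : Set.BijOn T {ξ | ξ ≠ a} {θ | θ ≠ b})
    (hT' : ∀ ξ, ξ ≠ a → HasFDerivAt T (T' ξ) ξ) {f h : E → ℝ}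
    (hfh : ∀ ξ, ξ ≠ a → |(T' ξ).det| * f (T ξ) = h ξ) :
    ∫ θ, f θ ∂ν = ∫ ξ, h ξ ∂ν := by
  have hms : MeasurableSet {ξ : E | ξ ≠ a} := (measurableSet_singleton a).compl
  have hfull (c : E) (k : E → ℝ) : ∫ x in {x | x ≠ c}, k x ∂ν = ∫ x, k x ∂ν := by
    rw [show {x : E | x ≠ c} = {c}ᶜ from rfl, Measure.restrict_eq_self_of_ae_mem]
    exact compl_mem_ae_iff.mpr (measure_singleton c)
  rw [← hfull b, ← hfull a, ← hbij.image_eq,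
    integral_image_eq_integral_abs_det_fderiv_smul ν hms
      (fun ξ hξ => (hT' ξ hξ).hasFDerivWithinAt) hbij.injOn]
  exact setIntegral_congr_fun hms fun ξ hξ => by simpa using hfh ξ hξ

/-- Weighted samples from the random map target `exp(-F)`: if the random map
`T(ξ) = μ + λ(ξ)ξ` (solving `F(T ξ) - φ = ½ξᵀHξ`) is a diffeomorphism of `ℝ^m \ {0}`
onto `ℝ^m \ {μ}` with Jacobian determinant `J`, then the self-normalized estimator with
weights `|J|` under the Gaussian `N(0, H⁻¹)` reference measure equals the posterior
expectation with density proportional to `exp (-F)`. -/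
theorem random_map_weighted_samples_consistent
    {m : ℕ} (F : EuclideanSpace ℝ (Fin m) → ℝ)
    (μv : EuclideanSpace ℝ (Fin m)) (φ : ℝ)
    (H : Matrix (Fin m) (Fin m) ℝ) (hH : H.PosDef)
    (hφ : ∀ θ, φ ≤ F θ) (hφμ : F μv = φ) (hF : ContDiff ℝ (⊤ : ℕ∞) F)
    (lam : EuclideanSpace ℝ (Fin m) → ℝ)
    (hlam_pos : ∀ ξ, ξ ≠ 0 → 0 < lam ξ)
    (T : EuclideanSpace ℝ (Fin m) → EuclideanSpace ℝ (Fin m))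
    (hT : ∀ ξ, T ξ = μv + lam ξ • ξ)
    (hsol : ∀ ξ, ξ ≠ 0 →
      F (T ξ) - φ = (1/2) * ((fun i => ξ i) ⬝ᵥ H *ᵥ (fun i => ξ i)))
    (hbij : Set.BijOn T {ξ | ξ ≠ 0} {θ | θ ≠ μv})
    (T' : EuclideanSpace ℝ (Fin m) →
      EuclideanSpace ℝ (Fin m) →L[ℝ] EuclideanSpace ℝ (Fin m))
    (hT' : ∀ ξ ∈ ({ξ | ξ ≠ 0} : Set (EuclideanSpace ℝ (Fin m))), HasFDerivAt T (T' ξ) ξ)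
    (J : EuclideanSpace ℝ (Fin m) → ℝ)
    (hJ : ∀ ξ, J ξ = LinearMap.det ((T' ξ).toLinearMap))
    (hJne : ∀ ξ, ξ ≠ 0 → J ξ ≠ 0)
    (u : EuclideanSpace ℝ (Fin m) → ℝ) (hu : Measurable u) (hub : ∃ C, ∀ x, |u x| ≤ C)
    (g : EuclideanSpace ℝ (Fin m) → ℝ)
    (hg : ∀ x, g x = (Real.sqrt ((2 * Real.pi) ^ m * (H⁻¹).det))⁻¹
      * Real.exp (-(1/2) * ((fun i => x i) ⬝ᵥ H *ᵥ (fun i => x i))))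
    (hint1 : Integrable (fun x => u (T x) * |J x| * g x))
    (hint2 : Integrable (fun x => |J x| * g x))
    (hint3 : Integrable (fun θ => Real.exp (-(F θ))))
    (hint4 : Integrable (fun θ => u θ * Real.exp (-(F θ))))
    (hpos : 0 < ∫ θ, Real.exp (-(F θ))) :
    (∫ x, u (T x) * |J x| * g x) / (∫ x, |J x| * g x)
      = (∫ θ, u θ * Real.exp (-(F θ))) / (∫ θ, Real.exp (-(F θ))) := by
  set c : ℝ := Real.sqrt ((2 * Real.pi) ^ m * (H⁻¹).det)
  have hc0 : c ≠ 0 := by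
    have := hH.inv.det_pos
    positivity
  have hweight (ξ : EuclideanSpace ℝ (Fin m)) (hξ : F (T ξ) - φ =
      (1/2) * ((fun i => ξ i) ⬝ᵥ H *ᵥ (fun i => ξ i))) :
      Real.exp (-(F (T ξ))) = Real.exp (-φ) * c * g ξ := by
    rw [hg, mul_assoc, mul_inv_cancel_left₀ hc0, ← Real.exp_add]
    congr 1
    linarith
  have key (v : EuclideanSpace ℝ (Fin m) → ℝ) :
      ∫ θ, v θ * Real.exp (-(F θ)) = Real.exp (-φ) * c * ∫ x, v (T x) * |J x| * g x := by
    rw [← integral_const_mul]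
    rcases Nat.eq_zero_or_pos m with rfl | hm
    · refine integral_congr_ae (.of_forall fun x => ?_)
      have hTx (y : EuclideanSpace ℝ (Fin 0)) : T y = y := Subsingleton.elim _ _
      have hJx : J x = 1 := by
        rw [hJ, Subsingleton.elim (T' x).toLinearMap LinearMap.id, LinearMap.det_id]
      have hFx := hweight x (by
        rw [Subsingleton.elim (T x) μv, hφμ]
        simp [dotProduct])
      rw [hTx] at hFx
      simp only [hTx, hJx, hFx, abs_one]
      ring
    · have : Nonempty (Fin m) := ⟨⟨0, hm⟩⟩
      refine integral_eq_of_bijOn_compl_singleton volume hbij hT' fun ξ hξ => ?_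
      rw [hweight ξ (hsol ξ hξ), hJ, ContinuousLinearMap.det]
      ring
  have key_one := key fun _ => 1
  simp only [one_mul] at key_one
  rw [key u, key_one, mul_div_mul_left _ _ (mul_ne_zero (Real.exp_ne_zero _) hc0)]
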